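/- Every 2-nested enriched matrix admits a suitable LR-ordering; indeed, every LR-ordering that underlies a total block bi-coloring of a 2-nested enriched matrix is suitable. -/

import Mathlib

/-- Labels for rows of an enriched matrix. -/
inductive RowLabel : Type
  | L | R | LR
deriving DecidableEq

/-- Colors for rows/blocks of an enriched matrix. -/
inductive RowColor : Type
  | red | blue
deriving DecidableEq

/-- An enriched matrix: a (0,1)-matrix whose rows may carry an optional label in
{L, R, LR} and an optional color in {red, blue}, where only L-rows, R-rows and
all-zero LR-rows may be colored, and all colored all-zero LR-rows have the same
color. -/
structure EnrichedMatrix (m n : ℕ) : Type where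
  entry : Fin m → Fin n → Bool
  label : Fin m → Option RowLabel
  color : Fin m → Option RowColor
  color_rows : ∀ i, (color i).isSome = true →
    label i = some RowLabel.L ∨ label i = some RowLabel.R ∨
      (label i = some RowLabel.LR ∧ ∀ j, entry i j = false)
  lr_color_unique : ∀ i k, label i = some RowLabel.LR → label k = some RowLabel.LR →
    (color i).isSome = true → (color k).isSome = true → color i = color k

namespace EnrichedMatrix

variable {m n : ℕ} (A : EnrichedMatrix m n)

/-- Two rows are disjoint: they share no 1-column. -/
def RowDisj (i k : Fin m) : Prop := ∀ j, ¬(A.entry i j = true ∧ A.entry k j = true)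

/-- Row `i` is contained in row `k`. -/
def RowLe (i k : Fin m) : Prop := ∀ j, A.entry i j = true → A.entry k j = true

/-- Two rows are nested: one is contained in the other. -/
def RowNested (i k : Fin m) : Prop := A.RowLe i k ∨ A.RowLe k i

/-- A row is nonempty: it has at least one 1. -/
def RowNonempty (i : Fin m) : Prop := ∃ j, A.entry i j = true

/-- Rows `i` and `k` are both colored, with the same color. -/
def SameColor (i k : Fin m) : Prop := ∃ c, A.color i = some c ∧ A.color k = some c

/-- Rows `i` and `k` are both colored, with distinct colors. -/
def DistinctColors (i k : Fin m) : Prop :=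
  ∃ c d, A.color i = some c ∧ A.color k = some d ∧ c ≠ d

end EnrichedMatrix
namespace EnrichedMatrix

variable {m n : ℕ}

/-- `σ` is an LR-ordering of the columns of `A`: under the column order `σ 0, σ 1, …`,
the 1s of every non-LR-row are consecutive, the 1s of every L-row form an initial
segment, the 1s of every R-row form a final segment, and the 0s of every LR-row are
consecutive. -/
def IsLROrdering (A : EnrichedMatrix m n) (σ : Equiv.Perm (Fin n)) : Prop :=
  (∀ i, A.label i ≠ some RowLabel.LR → ∀ a b c : Fin n, a ≤ b → b ≤ c →
      A.entry i (σ a) = true → A.entry i (σ c) = true → A.entry i (σ b) = true) ∧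
  (∀ i, A.label i = some RowLabel.L → ∀ p q : Fin n, q ≤ p →
      A.entry i (σ p) = true → A.entry i (σ q) = true) ∧
  (∀ i, A.label i = some RowLabel.R → ∀ p q : Fin n, p ≤ q →
      A.entry i (σ p) = true → A.entry i (σ q) = true) ∧
  (∀ i, A.label i = some RowLabel.LR → ∀ a b c : Fin n, a ≤ b → b ≤ c →
      A.entry i (σ a) = false → A.entry i (σ c) = false → A.entry i (σ b) = false)

/-- `A` admits an LR-ordering. -/
def LROrderable (A : EnrichedMatrix m n) : Prop := ∃ σ : Equiv.Perm (Fin n), A.IsLROrdering σ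

/-- Position `p` (w.r.t. the column ordering `σ`) belongs to the L-block of row `i`:
row `i` has 1s in all positions up to and including `p`. -/
def InLBlock (A : EnrichedMatrix m n) (σ : Equiv.Perm (Fin n)) (i : Fin m) (p : Fin n) : Prop :=
  ∀ q : Fin n, q ≤ p → A.entry i (σ q) = true

/-- Position `p` (w.r.t. the column ordering `σ`) belongs to the R-block of row `i`:
row `i` has 1s in all positions from `p` on. -/
def InRBlock (A : EnrichedMatrix m n) (σ : Equiv.Perm (Fin n)) (i : Fin m) (p : Fin n) : Prop :=
  ∀ q : Fin n, p ≤ q → A.entry i (σ q) = true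

/-- Position `p` belongs to the U-block of row `i`: row `i` has a 1 there. -/
def InUBlock (A : EnrichedMatrix m n) (σ : Equiv.Perm (Fin n)) (i : Fin m) (p : Fin n) : Prop :=
  A.entry i (σ p) = true

/-- Row `i` (labeled L or LR) has an L-block w.r.t. `σ`. -/
def HasLBlock (A : EnrichedMatrix m n) (σ : Equiv.Perm (Fin n)) (i : Fin m) : Prop :=
  (A.label i = some RowLabel.L ∨ A.label i = some RowLabel.LR) ∧ ∃ p, A.InLBlock σ i p

/-- Row `i` (labeled R or LR) has an R-block w.r.t. `σ`. -/
def HasRBlock (A : EnrichedMatrix m n) (σ : Equiv.Perm (Fin n)) (i : Fin m) : Prop :=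
  (A.label i = some RowLabel.R ∨ A.label i = some RowLabel.LR) ∧ ∃ p, A.InRBlock σ i p

/-- The LR-ordering `σ` of `A` is suitable: the L-block of each LR-row having exactly
two blocks is disjoint from every R-block, the R-block of each LR-row having exactly
two blocks is disjoint from every L-block, and for each LR-row every U-block is
disjoint from its L-block or disjoint from its R-block. -/
def SuitableLROrdering (A : EnrichedMatrix m n) (σ : Equiv.Perm (Fin n)) : Prop :=
  A.IsLROrdering σ ∧
  (∀ i, A.label i = some RowLabel.LR → A.HasLBlock σ i → A.HasRBlock σ i →
      (∃ p, A.entry i (σ p) = false) →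
      (∀ k, (A.label k = some RowLabel.R ∨ A.label k = some RowLabel.LR) →
        ∀ p, ¬(A.InLBlock σ i p ∧ A.InRBlock σ k p)) ∧
      (∀ k, (A.label k = some RowLabel.L ∨ A.label k = some RowLabel.LR) →
        ∀ p, ¬(A.InRBlock σ i p ∧ A.InLBlock σ k p))) ∧
  (∀ i, A.label i = some RowLabel.LR → ∀ k, A.label k = none →
      (∀ p, ¬(A.InLBlock σ i p ∧ A.InUBlock σ k p)) ∨
      (∀ p, ¬(A.InRBlock σ i p ∧ A.InUBlock σ k p)))

end EnrichedMatrix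

namespace EnrichedMatrix

/-- A total block bi-coloring of an enriched matrix `A`: an LR-ordering `σ` together
with an assignment of a color to every block (the L-block, R-block and U-block of each
row, where meaningful) satisfying conditions (1)–(9) of the definition of 2-nested
matrices. -/
structure TotalBlockBicoloring {m n : ℕ} (A : EnrichedMatrix m n) : Type where
  /-- the LR-ordering of the columns -/
  σ : Equiv.Perm (Fin n)
  ord : A.IsLROrdering σ
  /-- color of the L-block of each row (meaningful for rows having an L-block) -/
  colL : Fin m → RowColor
  /-- color of the R-block of each row (meaningful for rows having an R-block) -/
  colR : Fin m → RowColor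
  /-- color of the U-block of each unlabeled row -/
  colU : Fin m → RowColor
  /-- (1) if an LR-row has an L-block and an R-block, they are colored distinctly -/
  cond1 : ∀ i, A.label i = some RowLabel.LR → A.HasLBlock σ i → A.HasRBlock σ i →
    colL i ≠ colR i
  /-- (2) the only block of a nonempty colored (L-) row has the color of the row -/
  cond2L : ∀ i c, A.RowNonempty i → A.color i = some c → A.label i = some RowLabel.L →
    colL i = c
  /-- (2) the only block of a nonempty colored (R-) row has the color of the row -/
  cond2R : ∀ i c, A.RowNonempty i → A.color i = some c → A.label i = some RowLabel.R →
    colR i = c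
  /-- (3) an L-block of an LR-row properly contained in the L-block of an L-row gets a
  different color -/
  cond3L : ∀ i k, A.label i = some RowLabel.LR → A.label k = some RowLabel.L →
    A.HasLBlock σ i → A.HasLBlock σ k →
    (∀ p, A.InLBlock σ i p → A.InLBlock σ k p) →
    (∃ p, A.InLBlock σ k p ∧ ¬ A.InLBlock σ i p) →
    colL i ≠ colL k
  /-- (3) an R-block of an LR-row properly contained in the R-block of an R-row gets a
  different color -/
  cond3R : ∀ i k, A.label i = some RowLabel.LR → A.label k = some RowLabel.R →
    A.HasRBlock σ i → A.HasRBlock σ k →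
    (∀ p, A.InRBlock σ i p → A.InRBlock σ k p) →
    (∃ p, A.InRBlock σ k p ∧ ¬ A.InRBlock σ i p) →
    colR i ≠ colR k
  /-- (4) every L-block of an LR-row is disjoint from every R-block -/
  cond4L : ∀ i k, A.label i = some RowLabel.LR →
    (A.label k = some RowLabel.R ∨ A.label k = some RowLabel.LR) →
    ∀ p, ¬(A.InLBlock σ i p ∧ A.InRBlock σ k p)
  /-- (4) every R-block of an LR-row is disjoint from every L-block -/
  cond4R : ∀ i k, A.label i = some RowLabel.LR →
    (A.label k = some RowLabel.L ∨ A.label k = some RowLabel.LR) →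
    ∀ p, ¬(A.InRBlock σ i p ∧ A.InLBlock σ k p)
  /-- (5) a non-disjoint L-block and R-block are colored distinctly -/
  cond5 : ∀ i k, (A.label i = some RowLabel.L ∨ A.label i = some RowLabel.LR) →
    (A.label k = some RowLabel.R ∨ A.label k = some RowLabel.LR) →
    (∃ p, A.InLBlock σ i p ∧ A.InRBlock σ k p) → colL i ≠ colR k
  /-- (6) two U-blocks of the same color are disjoint or nested -/
  cond6 : ∀ i k, A.label i = none → A.label k = none → colU i = colU k →
    (∀ p, ¬(A.InUBlock σ i p ∧ A.InUBlock σ k p)) ∨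
    (∀ p, A.InUBlock σ i p → A.InUBlock σ k p) ∨
    (∀ p, A.InUBlock σ k p → A.InUBlock σ i p)
  /-- (7) an L-block and a U-block of the same color are disjoint, or the U-block is
  contained in the L-block -/
  cond7L : ∀ i k, (A.label i = some RowLabel.L ∨ A.label i = some RowLabel.LR) →
    A.label k = none → colL i = colU k →
    (∀ p, ¬(A.InLBlock σ i p ∧ A.InUBlock σ k p)) ∨
    (∀ p, A.InUBlock σ k p → A.InLBlock σ i p)
  /-- (7) an R-block and a U-block of the same color are disjoint, or the U-block is
  contained in the R-block -/
  cond7R : ∀ i k, (A.label i = some RowLabel.R ∨ A.label i = some RowLabel.LR) →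
    A.label k = none → colR i = colU k →
    (∀ p, ¬(A.InRBlock σ i p ∧ A.InUBlock σ k p)) ∨
    (∀ p, A.InUBlock σ k p → A.InRBlock σ i p)
  /-- (8) if two L-blocks of non-LR-rows are colored distinctly, every LR-row has an
  L-block -/
  cond8L : ∀ i k, A.label i = some RowLabel.L → A.label k = some RowLabel.L →
    A.HasLBlock σ i → A.HasLBlock σ k → colL i ≠ colL k →
    ∀ r, A.label r = some RowLabel.LR → A.HasLBlock σ r
  /-- (8) if two R-blocks of non-LR-rows are colored distinctly, every LR-row has an
  R-block -/
  cond8R : ∀ i k, A.label i = some RowLabel.R → A.label k = some RowLabel.R →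
    A.HasRBlock σ i → A.HasRBlock σ k → colR i ≠ colR k →
    ∀ r, A.label r = some RowLabel.LR → A.HasRBlock σ r
  /-- (9) if two LR-rows overlap, the L-block of one and the R-block of the other have
  the same color -/
  cond9 : ∀ i k, A.label i = some RowLabel.LR → A.label k = some RowLabel.LR →
    A.RowNonempty i → A.RowNonempty k → ¬ A.RowDisj i k → ¬ A.RowNested i k →
    colL i = colR k

/-- An enriched matrix is 2-nested if it admits a total block bi-coloring. -/
def TwoNested {m n : ℕ} (A : EnrichedMatrix m n) : Prop :=
  Nonempty A.TotalBlockBicoloring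

end EnrichedMatrix

/-- Every LR-ordering underlying a total block bi-coloring of an enriched matrix is
suitable; consequently, every 2-nested enriched matrix admits a suitable LR-ordering. -/
theorem two_nested_suitable_LROrdering {m n : ℕ} :
    (∀ (A : EnrichedMatrix m n) (b : A.TotalBlockBicoloring),
      A.SuitableLROrdering b.σ) ∧
    (∀ A : EnrichedMatrix m n, A.TwoNested →
      ∃ σ : Equiv.Perm (Fin n), A.SuitableLROrdering σ) := by
  have key : ∀ (A : EnrichedMatrix m n) (b : A.TotalBlockBicoloring),
      A.SuitableLROrdering b.σ := by
    intro A b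
    refine ⟨b.ord, fun i hi _ _ _ => ⟨fun k hk p => b.cond4L i k hi hk p,
      fun k hk p => b.cond4R i k hi hk p⟩, fun i hi k hk => ?_⟩
    by_contra! h
    obtain ⟨⟨p, hpL, hpU⟩, q, hqR, hqU⟩ := h
    have hne := b.cond1 i hi ⟨Or.inr hi, p, hpL⟩ ⟨Or.inr hi, q, hqR⟩
    -- with only two colors, the U-block shares its color with the L-block or the R-block
    have hcol : b.colL i = b.colU k ∨ b.colR i = b.colU k := by
      revert hne
      cases b.colL i <;> cases b.colR i <;> cases b.colU k <;> simp
    rcases hcol with hc | hc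
    · rcases b.cond7L i k (Or.inr hi) hk hc with h | h
      · exact h p ⟨hpL, hpU⟩
      · exact b.cond4L i i hi (Or.inr hi) q ⟨h q hqU, hqR⟩
    · rcases b.cond7R i k (Or.inr hi) hk hc with h | h
      · exact h q ⟨hqR, hqU⟩
      · exact b.cond4L i i hi (Or.inr hi) p ⟨hpL, h p hpU⟩
  exact ⟨key, fun A ⟨b⟩ => ⟨b.σ, key A b⟩⟩
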